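/- For every k ≥ 2, the diagonal coloring of (k+1)-WL refines the diagonal coloring of k-WL, and 1-WL pre-colored with Δ((k+1)-WL) is strictly more expressive than 1-WL pre-colored with Δ(k-WL): every pair of graphs distinguished by the latter is distinguished by the former, and there exists a pair of non-isomorphic graphs distinguished by the former but not the latter. -/

import Mathlib

def WLType (α : Type) : ℕ → Type
  | 0 => α
  | n + 1 => WLType α n × Multiset (WLType α n)

open Classical in
/-- `n` rounds of 1-WL refinement: `C'(v) = (C(v), {{C(x) : x ∈ N(v)}})`. -/
noncomputable def wl {V : Type} [Fintype V] {α : Type} (G : SimpleGraph V) (C : V → α) :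
    (n : ℕ) → V → WLType α n
  | 0 => C
  | n + 1 => fun v =>
      (wl G C n v, Multiset.map (wl G C n) (Finset.univ.val.filter (fun x => G.Adj v x)))

/-- The multiset of 1-WL colors of all vertices after `n` rounds. -/
noncomputable def wlColors {V : Type} [Fintype V] {α : Type} (G : SimpleGraph V)
    (C : V → α) (n : ℕ) : Multiset (WLType α n) :=
  Finset.univ.val.map (wl G C n)

def kInit {V : Type} (G : SimpleGraph V) (k : ℕ) (t : Fin k → V) :
    (Fin k → Fin k → Prop) × (Fin k → Fin k → Prop) :=
  (fun i j => t i = t j, fun i j => G.Adj (t i) (t j))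

def KWLType (k : ℕ) : ℕ → Type
  | 0 => (Fin k → Fin k → Prop) × (Fin k → Fin k → Prop)
  | n + 1 => KWLType k n × (Fin k → Multiset (KWLType k n))

def kwl {V : Type} [Fintype V] (G : SimpleGraph V) (k : ℕ) :
    (n : ℕ) → (Fin k → V) → KWLType k n
  | 0 => kInit G k
  | n + 1 => fun t => (kwl G k n t,
      fun j => Finset.univ.val.map (fun w => kwl G k n (Function.update t j w)))

/-- A number of `k`-WL iterations after which the coloring of the disjoint union of
`G₁` and `G₂` is guaranteed to have stabilized. -/
def stableSteps (V₁ V₂ : Type) [Fintype V₁] [Fintype V₂] (k : ℕ) : ℕ :=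
  Fintype.card ((Fin k → V₁) ⊕ (Fin k → V₂))

/-- The stable diagonal `k`-WL coloring `Δ(k-WL)(v) = C_{k-WL}(v,…,v)`, computed for the
pair `(G₁, G₂)` (the stabilization number of iterations is that of the pair). -/
def kwlDiag {V₁ V₂ V : Type} [Fintype V₁] [Fintype V₂] [Fintype V]
    (G : SimpleGraph V) (k : ℕ) (v : V) : KWLType k (stableSteps V₁ V₂ k) :=
  kwl G k (stableSteps V₁ V₂ k) (fun _ => v)

section Refinement

/-- The action of a map of colors on iterated 1-WL colors. -/
def WLType.map {α β : Type} (φ : α → β) : (n : ℕ) → WLType α n → WLType β n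
  | 0 => φ
  | n + 1 => fun c => (WLType.map φ n c.1, c.2.map (WLType.map φ n))

theorem wl_comp {V : Type} [Fintype V] {α β : Type} (G : SimpleGraph V) (φ : α → β)
    (C : V → α) (n : ℕ) : wl G (φ ∘ C) n = WLType.map φ n ∘ wl G C n := by
  induction n with
  | zero => rfl
  | succ n ih =>
    funext v
    refine Prod.ext (congrFun ih v) ?_
    change Multiset.map (wl G (φ ∘ C) n) _ =
      Multiset.map (WLType.map φ n) (Multiset.map (wl G C n) _)
    rw [ih, Multiset.map_map]

theorem wlColors_comp {V : Type} [Fintype V] {α β : Type} (G : SimpleGraph V) (φ : α → β)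
    (C : V → α) (n : ℕ) :
    wlColors G (φ ∘ C) n = (wlColors G C n).map (WLType.map φ n) := by
  rw [wlColors, wlColors, wl_comp, Multiset.map_map]

theorem wlColors_eq_of_refines {V₁ V₂ : Type} [Fintype V₁] [Fintype V₂] {α β : Type}
    (C₁ : V₁ → α) (C₂ : V₂ → α) (D₁ : V₁ → β) (D₂ : V₂ → β)
    (h : ∀ u w, Sum.elim C₁ C₂ u = Sum.elim C₁ C₂ w → Sum.elim D₁ D₂ u = Sum.elim D₁ D₂ w)
    (G₁ : SimpleGraph V₁) (G₂ : SimpleGraph V₂) (m : ℕ)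
    (e : wlColors G₁ C₁ m = wlColors G₂ C₂ m) : wlColors G₁ D₁ m = wlColors G₂ D₂ m := by
  have hfac : Function.FactorsThrough (Sum.elim D₁ D₂) (Sum.elim C₁ C₂) :=
    fun u w huw => h u w huw
  rcases isEmpty_or_nonempty (V₁ ⊕ V₂) with hV | hV
  · obtain ⟨_, _⟩ := isEmpty_sum.1 hV
    simp [wlColors]
  · have : Nonempty β := hV.map (Sum.elim D₁ D₂)
    obtain ⟨φ, hφ⟩ := (Function.factorsThrough_iff _).1 hfac
    have h₁ : D₁ = φ ∘ C₁ := funext fun v => congrFun hφ (Sum.inl v)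
    have h₂ : D₂ = φ ∘ C₂ := funext fun v => congrFun hφ (Sum.inr v)
    rw [h₁, h₂, wlColors_comp, wlColors_comp, e]

theorem kwl_eq_of_le {V W : Type} [Fintype V] [Fintype W] (G : SimpleGraph V)
    (H : SimpleGraph W) (k : ℕ) {m n : ℕ} (hmn : m ≤ n) (t : Fin k → V) (s : Fin k → W)
    (h : kwl G k n t = kwl H k n s) : kwl G k m t = kwl H k m s := by
  induction n, hmn using Nat.le_induction with
  | base => exact h
  | succ n _ ih => exact ih (congrArg Prod.fst h)

theorem kwl_succ_rel {V W : Type} [Fintype V] [Fintype W] (G : SimpleGraph V)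
    (H : SimpleGraph W) (k n : ℕ) (t : Fin k → V) (s : Fin k → W)
    (h : kwl G k (n + 1) t = kwl H k (n + 1) s) (j : Fin k) :
    Multiset.Rel (fun v w => kwl G k n (Function.update t j v) =
      kwl H k n (Function.update s j w)) Finset.univ.val Finset.univ.val := by
  exact Multiset.rel_map.1 (Multiset.rel_eq.2 (congrFun (congrArg Prod.snd h) j))

theorem kwl_castSucc_eq {V W : Type} [Fintype V] [Fintype W] (G : SimpleGraph V)
    (H : SimpleGraph W) (k n : ℕ) (t : Fin (k + 1) → V) (s : Fin (k + 1) → W)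
    (h : kwl G (k + 1) n t = kwl H (k + 1) n s) :
    kwl G k n (t ∘ Fin.castSucc) = kwl H k n (s ∘ Fin.castSucc) := by
  induction n generalizing t s with
  | zero =>
    refine Prod.ext ?_ ?_
    · funext i j
      exact congrFun (congrFun (congrArg Prod.fst h) i.castSucc) j.castSucc
    · funext i j
      exact congrFun (congrFun (congrArg Prod.snd h) i.castSucc) j.castSucc
  | succ n ih =>
    refine Prod.ext (ih t s (congrArg Prod.fst h)) ?_
    funext j
    refine Multiset.rel_eq.1 (Multiset.rel_map.2 ?_)
    refine (kwl_succ_rel G H (k + 1) n t s h j.castSucc).mono fun v _ w _ hvw => ?_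
    have := ih _ _ hvw
    rwa [Function.update_comp_eq_of_injective _ (Fin.castSucc_injective k),
      Function.update_comp_eq_of_injective _ (Fin.castSucc_injective k)] at this

theorem stableSteps_le_succ (V₁ V₂ : Type) [Fintype V₁] [Fintype V₂] {k : ℕ} (hk : k ≠ 0) :
    stableSteps V₁ V₂ k ≤ stableSteps V₁ V₂ (k + 1) := by
  have key : ∀ c : ℕ, c ^ k ≤ c ^ (k + 1) := by
    intro c
    rcases Nat.eq_zero_or_pos c with rfl | hc
    · simp [hk]
    · exact Nat.pow_le_pow_right hc k.le_succ
  simp only [stableSteps, Fintype.card_sum, Fintype.card_pi, Finset.prod_const,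
    Finset.card_univ, Fintype.card_fin]
  exact Nat.add_le_add (key _) (key _)

theorem kwlDiag_refines {V₁ V₂ : Type} [Fintype V₁] [Fintype V₂] {k : ℕ} (hk : k ≠ 0)
    (G₁ : SimpleGraph V₁) (G₂ : SimpleGraph V₂) (u w : V₁ ⊕ V₂)
    (h : Sum.elim (kwlDiag (V₁ := V₁) (V₂ := V₂) G₁ (k + 1))
          (kwlDiag (V₁ := V₁) (V₂ := V₂) G₂ (k + 1)) u =
        Sum.elim (kwlDiag (V₁ := V₁) (V₂ := V₂) G₁ (k + 1))
          (kwlDiag (V₁ := V₁) (V₂ := V₂) G₂ (k + 1)) w) :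
    Sum.elim (kwlDiag (V₁ := V₁) (V₂ := V₂) G₁ k)
          (kwlDiag (V₁ := V₁) (V₂ := V₂) G₂ k) u =
        Sum.elim (kwlDiag (V₁ := V₁) (V₂ := V₂) G₁ k)
          (kwlDiag (V₁ := V₁) (V₂ := V₂) G₂ k) w := by
  have hle := stableSteps_le_succ V₁ V₂ hk
  rcases u with u | u <;> rcases w with w | w <;>
    exact kwl_castSucc_eq _ _ k _ _ _ (kwl_eq_of_le _ _ (k + 1) hle _ _ h)

end Refinement

section PebbleGame

theorem map_univ_eq_of_equiv {V W α : Type} [Fintype V] [Fintype W] (f : V → α) (g : W → α)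
    (ψ : V ≃ W) (h : ∀ v, f v = g (ψ v)) :
    Finset.univ.val.map f = Finset.univ.val.map g := by
  rw [← Finset.map_univ_equiv ψ, Finset.map_val, Multiset.map_map]
  exact Multiset.map_congr rfl fun v _ => h v

/-- `R` is a set of positions from which Duplicator can play forever in the bijective
`k`-pebble game on `G` and `H`. -/
structure IsBackAndForth {V W : Type} (G : SimpleGraph V) (H : SimpleGraph W) (k : ℕ)
    (R : (Fin k → V) → (Fin k → W) → Prop) : Prop where
  init : ∀ t s, R t s → kInit G k t = kInit H k s
  step : ∀ t s, R t s → ∀ j, ∃ ψ : V ≃ W, ∀ v,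
    R (Function.update t j v) (Function.update s j (ψ v))
  reindex : ∀ t s, R t s → ∀ π : Fin k → Fin k, R (t ∘ π) (s ∘ π)

namespace IsBackAndForth

variable {V W : Type} {G : SimpleGraph V} {H : SimpleGraph W} {k : ℕ}
  {R : (Fin k → V) → (Fin k → W) → Prop}

theorem comap (hR : IsBackAndForth G H k R) {V' W' : Type} (e : V' ≃ V) (f : W' ≃ W) :
    IsBackAndForth (G.comap e) (H.comap f) k (fun t s => R (e ∘ t) (f ∘ s)) where
  init t s hts := by
    have h := hR.init _ _ hts
    refine Prod.ext ?_ (congrArg Prod.snd h :)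
    funext i j
    have := congrFun (congrFun (congrArg Prod.fst h) i) j
    simpa [kInit] using this
  step t s hts j := by
    obtain ⟨ψ, hψ⟩ := hR.step _ _ hts j
    refine ⟨(e.trans ψ).trans f.symm, fun v => ?_⟩
    simpa [Function.comp_update] using hψ (e v)
  reindex t s hts π := hR.reindex _ _ hts π

variable [Fintype V] [Fintype W]

theorem kwl_eq (hR : IsBackAndForth G H k R) (n : ℕ) {t : Fin k → V} {s : Fin k → W}
    (hts : R t s) : kwl G k n t = kwl H k n s := by
  induction n generalizing t s with
  | zero => exact hR.init t s hts
  | succ n ih =>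
    refine Prod.ext (ih hts) (funext fun j => ?_)
    obtain ⟨ψ, hψ⟩ := hR.step t s hts j
    exact map_univ_eq_of_equiv _ _ ψ fun v => ih (hψ v)

theorem wl_eq (hR : IsBackAndForth G H k R) (hk : 2 ≤ k) (n m : ℕ) {v : V} {w : W}
    (hvw : R (fun _ => v) (fun _ => w)) :
    wl G (fun v => kwl G k n fun _ => v) m v = wl H (fun w => kwl H k n fun _ => w) m w := by
  classical
  induction m generalizing v w with
  | zero => exact hR.kwl_eq n hvw
  | succ m ih =>
    refine Prod.ext (ih hvw) ?_
    let i : Fin k := ⟨0, by omega⟩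
    let j : Fin k := ⟨1, by omega⟩
    have hij : i ≠ j := by simp [i, j]
    obtain ⟨ψ, hψ⟩ := hR.step _ _ hvw j
    have hadj (x : V) : G.Adj v x ↔ H.Adj w (ψ x) := by
      have := congrFun (congrFun (congrArg Prod.snd (hR.init _ _ (hψ x))) i) j
      simpa [kInit, hij] using this
    have hx (x : V) : R (fun _ => x) (fun _ => ψ x) := by
      have := hR.reindex _ _ (hψ x) (fun _ => j)
      simpa [Function.comp_def] using this
    change Multiset.map _ (Finset.univ.val.filter _) = Multiset.map _ (Finset.univ.val.filter _)
    rw [← Finset.map_univ_equiv ψ, Finset.map_val, Multiset.filter_map, Multiset.map_map]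
    refine Multiset.map_congr ?_ fun x _ => ih (hx x)
    exact Multiset.filter_congr fun x _ => hadj x

theorem wlColors_eq (hR : IsBackAndForth G H k R) (hk : 2 ≤ k) (n m : ℕ) (ψ : V ≃ W)
    (hψ : ∀ v, R (fun _ => v) (fun _ => ψ v)) :
    wlColors G (fun v => kwl G k n fun _ => v) m =
      wlColors H (fun w => kwl H k n fun _ => w) m :=
  map_univ_eq_of_equiv _ _ ψ fun v => hR.wl_eq hk n m (hψ v)

end IsBackAndForth

end PebbleGame

section Cliques

theorem exists_kwl_eq_of_kwl_add_eq {V W : Type} [Fintype V] [Fintype W] (G : SimpleGraph V)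
    (H : SimpleGraph W) (k n r : ℕ) (t : Fin k → V) (s : Fin k → W)
    (h : kwl G k (n + r) t = kwl H k (n + r) s) (c : Fin k → V) :
    ∃ d, kwl G k n (fun i => if i.val < r then c i else t i) = kwl H k n d := by
  induction r generalizing n with
  | zero => exact ⟨s, by simpa using h⟩
  | succ r ih =>
    obtain ⟨d, hd⟩ := ih (n + 1) (by rwa [Nat.add_right_comm])
    by_cases hr : r < k
    · have hrel := kwl_succ_rel G H k n _ _ hd ⟨r, hr⟩
      obtain ⟨w, -, hw⟩ := Multiset.exists_mem_of_rel_of_mem hrel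
        (Finset.mem_univ_val (c ⟨r, hr⟩))
      refine ⟨_, Eq.trans (congrArg _ (funext fun i => ?_)) hw⟩
      rcases eq_or_ne i ⟨r, hr⟩ with rfl | hi
      · simp
      · have : i.val ≠ r := fun e => hi (Fin.ext e)
        rw [Function.update_of_ne hi]
        exact if_congr (by omega) rfl rfl
    · refine ⟨d, Eq.trans (congrArg _ (funext fun i => ?_)) (congrArg Prod.fst hd)⟩
      exact if_congr (by have := i.isLt; omega) rfl rfl

theorem exists_adj_of_kwl_eq {V W : Type} [Fintype V] [Fintype W] (G : SimpleGraph V)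
    (H : SimpleGraph W) {k n : ℕ} (hkn : k ≤ n) (t : Fin k → V) (s : Fin k → W)
    (h : kwl G k n t = kwl H k n s) (c : Fin k → V) :
    ∃ d : Fin k → W, ∀ i j, H.Adj (d i) (d j) ↔ G.Adj (c i) (c j) := by
  obtain ⟨d, hd⟩ := exists_kwl_eq_of_kwl_add_eq G H k 0 k t s
    (by rw [Nat.zero_add]; exact kwl_eq_of_le G H k hkn t s h) c
  refine ⟨d, fun i j => ?_⟩
  have := congrFun (congrFun (congrArg Prod.snd hd) i) j
  simpa [kwl, kInit] using this.symm

theorem le_stableSteps {V₁ : Type} (V₂ : Type) [Fintype V₁] [Fintype V₂] {k : ℕ} (hk : k ≠ 0)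
    (c : Fin k ↪ V₁) : k ≤ stableSteps V₁ V₂ k := by
  have hc := Fintype.card_le_of_embedding c
  simp only [stableSteps, Fintype.card_sum, Fintype.card_pi, Finset.prod_const,
    Finset.card_univ, Fintype.card_fin] at hc ⊢
  exact (hc.trans (Nat.le_self_pow hk _)).trans (Nat.le_add_right _ _)

theorem wlColors_kwlDiag_ne_of_clique {V₁ V₂ : Type} [Fintype V₁] [Fintype V₂]
    (G : SimpleGraph V₁) (H : SimpleGraph V₂) {k : ℕ} (hk : k ≠ 0)
    (hG : ∃ c : Fin k → V₁, ∀ i j, i ≠ j → G.Adj (c i) (c j))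
    (hH : ¬ ∃ c : Fin k → V₂, ∀ i j, i ≠ j → H.Adj (c i) (c j)) :
    wlColors G (kwlDiag (V₁ := V₁) (V₂ := V₂) G k) 0 ≠
      wlColors H (kwlDiag (V₁ := V₁) (V₂ := V₂) H k) 0 := by
  intro e
  obtain ⟨c, hc⟩ := hG
  have hinj : Function.Injective c := fun i j hij => by
    by_contra hne
    exact G.irrefl (hij ▸ hc i j hne)
  have hle := le_stableSteps V₂ hk ⟨c, hinj⟩
  obtain ⟨w, -, hw⟩ := Multiset.exists_mem_of_rel_of_mem
    (Multiset.rel_map.1 (Multiset.rel_eq.2 e))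
    (Finset.mem_univ_val (c ⟨0, Nat.pos_of_ne_zero hk⟩))
  obtain ⟨d, hd⟩ := exists_adj_of_kwl_eq G H hle _ _ hw c
  exact hH ⟨d, fun i j hij => (hd i j).2 (hc i j hij)⟩

end Cliques

section CFI

/-- A vertex of the Cai-Fürer-Immerman graph over the complete graph on `Fin n`: a base
vertex together with an even set of base edges at it. -/
def CFIVertex (n : ℕ) : Type :=
  {p : Fin n × (Fin n → ZMod 2) // p.2 p.1 = 0 ∧ ∑ w, p.2 w = 0}

instance (n : ℕ) : Fintype (CFIVertex n) :=
  inferInstanceAs (Fintype {p : Fin n × (Fin n → ZMod 2) // p.2 p.1 = 0 ∧ ∑ w, p.2 w = 0})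

namespace CFIVertex

variable {n : ℕ}

def base (p : CFIVertex n) : Fin n := p.1.1

def vec (p : CFIVertex n) : Fin n → ZMod 2 := p.1.2

theorem vec_base (p : CFIVertex n) : p.vec p.base = 0 := p.2.1

theorem sum_vec (p : CFIVertex n) : ∑ w, p.vec w = 0 := p.2.2

theorem ext {p q : CFIVertex n} (hb : p.base = q.base) (hv : p.vec = q.vec) : p = q :=
  Subtype.ext (Prod.ext hb hv)

/-- Translation of each gadget by an even vector. -/
def shift (g : Fin n → Fin n → ZMod 2) (hd : ∀ v, g v v = 0) (hs : ∀ v, ∑ w, g v w = 0) :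
    CFIVertex n ≃ CFIVertex n :=
  let φ : CFIVertex n → CFIVertex n := fun p => ⟨(p.base, p.vec + g p.base), by
    simp [p.vec_base, hd], by simp [Finset.sum_add_distrib, p.sum_vec, hs]⟩
  have hφ : Function.Involutive φ := fun p => ext rfl <| by
    change p.vec + g p.base + g p.base = p.vec
    funext w
    simp [add_assoc, CharTwo.add_self_eq_zero]
  hφ.toPerm

theorem vec_shift (g : Fin n → Fin n → ZMod 2) (hd hs) (p : CFIVertex n) :
    (shift g hd hs p).vec = p.vec + g p.base := rfl

end CFIVertex

/-- The Cai-Fürer-Immerman graph over the complete graph on `Fin n`, where the base edge `vw`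
is twisted by `f v w + f w v`. -/
def cfiGraph {n : ℕ} (f : Fin n → Fin n → ZMod 2) : SimpleGraph (CFIVertex n) where
  Adj p q := p.base ≠ q.base ∧
    p.vec q.base + q.vec p.base = f p.base q.base + f q.base p.base
  symm := ⟨fun _ _ h => ⟨h.1.symm, by rw [add_comm, h.2, add_comm]⟩⟩
  loopless := ⟨fun _ h => h.1 rfl⟩

theorem sum_sum_eq_zero_of_symm {n : ℕ} (y : Fin n → Fin n → ZMod 2)
    (hd : ∀ v, y v v = 0) (hy : ∀ v w, v ≠ w → y v w + y w v = 0) :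
    ∑ v, ∑ w, y v w = 0 := by
  rw [← Fintype.sum_prod_type' y]
  refine Finset.sum_involution (fun p _ => p.swap) ?_ ?_ (by simp) (by simp)
  · rintro ⟨v, w⟩ -
    rcases eq_or_ne v w with rfl | h
    · simp [hd]
    · exact hy v w h
  · rintro ⟨v, w⟩ - hne heq
    obtain rfl : w = v := congrArg Prod.fst heq
    exact hne (hd w)

theorem not_exists_cfiGraph_clique {n : ℕ} (f : Fin n → Fin n → ZMod 2)
    (hd : ∀ v, f v v = 0) (hf : ∑ v, ∑ w, f v w ≠ 0) :
    ¬ ∃ c : Fin n → CFIVertex n, ∀ i j, i ≠ j → (cfiGraph f).Adj (c i) (c j) := by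
  rintro ⟨c, hc⟩
  have hinj : Function.Injective fun i => (c i).base := fun i j hij => by
    by_contra hne
    exact (hc i j hne).1 hij
  obtain ⟨g, hg⟩ := (Finite.injective_iff_surjective.1 hinj).hasRightInverse
  have hb (v : Fin n) : (c (g v)).base = v := hg v
  have key := sum_sum_eq_zero_of_symm (fun v w => (c (g v)).vec w + f v w) (fun v => by
      have := (c (g v)).vec_base
      rw [hb] at this
      simp [this, hd]) fun v w hvw => by
    have h := (hc (g v) (g w) (hg.injective.ne hvw)).2
    rw [hb, hb] at h
    rw [add_add_add_comm, h, CharTwo.add_self_eq_zero]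
  simp [Finset.sum_add_distrib, CFIVertex.sum_vec] at key
  exact hf key

theorem exists_cfiGraph_zero_clique (n : ℕ) :
    ∃ c : Fin n → CFIVertex n, ∀ i j, i ≠ j → (cfiGraph 0).Adj (c i) (c j) :=
  ⟨fun i => ⟨(i, 0), by simp⟩, fun i j hij => ⟨hij, by simp [CFIVertex.vec]⟩⟩

/-- `f` moves the twist of `f₀` to the gadget of `a`: translation by `f` is a well-defined
isomorphism from the untwisted graph to the graph twisted by `f₀` away from `a`. -/
structure IsTwistAt {n : ℕ} (f₀ : Fin n → Fin n → ZMod 2) (a : Fin n)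
    (f : Fin n → Fin n → ZMod 2) : Prop where
  diag : ∀ v, f v v = 0
  sum : ∀ v, ∑ w, f v w = if v = a then 1 else 0
  edge : ∀ v w, v ≠ w → f v w + f w v = f₀ v w + f₀ w v

namespace IsTwistAt

variable {n : ℕ} {f₀ f : Fin n → Fin n → ZMod 2} {a b : Fin n}

theorem move (hf : IsTwistAt f₀ a f) (hab : a ≠ b) :
    IsTwistAt f₀ b (f + Pi.single a (Pi.single b 1) + Pi.single b (Pi.single a 1)) := by
  constructor
  · intro v
    have := hf.diag v
    rcases eq_or_ne v a with rfl | hva <;> rcases eq_or_ne v b with rfl | hvb <;>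
      simp_all
  · intro v
    have := hf.sum v
    rcases eq_or_ne v a with rfl | hva <;> rcases eq_or_ne v b with rfl | hvb <;>
      simp_all [Finset.sum_add_distrib, CharTwo.add_self_eq_zero]
  · intro v w hvw
    rw [← hf.edge v w hvw]
    have h2 : (1 : ZMod 2) + 1 = 0 := rfl
    simp only [Pi.add_apply, Pi.single_apply, ite_apply, Pi.zero_apply]
    split_ifs <;> grind

theorem exists_equiv (hf : IsTwistAt f₀ a f) (hab : a ≠ b) :
    ∃ (ψ : CFIVertex n ≃ CFIVertex n) (f' : Fin n → Fin n → ZMod 2), IsTwistAt f₀ b f' ∧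
      (∀ v, v ≠ a → v ≠ b → f' v = f v) ∧ (∀ p, (ψ p).base = p.base) ∧
      (∀ p, p.base ≠ a → (ψ p).vec = p.vec + f p.base) ∧
      (∀ p, p.base = a → (ψ p).vec = p.vec + f' p.base) := by
  have hm := hf.move hab
  set f' := f + Pi.single a (Pi.single b 1) + Pi.single b (Pi.single a 1) with hf'
  refine ⟨CFIVertex.shift (Function.update f a (f' a)) ?_ ?_, f', hm, ?_, fun p => rfl, ?_, ?_⟩
  · intro v
    rcases eq_or_ne v a with rfl | hva
    · simpa using hm.diag v
    · simpa [hva] using hf.diag v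
  · intro v
    rcases eq_or_ne v a with rfl | hva
    · simpa [hab] using hm.sum v
    · simpa [hva] using hf.sum v
  · intro v hva hvb
    simp [hf', hva, hvb]
  · intro p hp
    rw [CFIVertex.vec_shift, Function.update_of_ne hp]
  · intro p hp
    rw [CFIVertex.vec_shift, hp, Function.update_self]

end IsTwistAt

/-- Winning positions for Duplicator on the Cai-Fürer-Immerman graphs: the twist can be moved
to a gadget that carries no pebble. -/
def CFIPosition {n k : ℕ} (f₀ : Fin n → Fin n → ZMod 2) (t s : Fin k → CFIVertex n) : Prop :=
  ∃ a f, IsTwistAt f₀ a f ∧ ∀ i, (t i).base ≠ a ∧ (s i).base = (t i).base ∧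
    (s i).vec = (t i).vec + f (t i).base

theorem isBackAndForth_cfiPosition {n k : ℕ} (hkn : k < n) (f₀ : Fin n → Fin n → ZMod 2) :
    IsBackAndForth (cfiGraph 0) (cfiGraph f₀) k (CFIPosition f₀) where
  init := by
    rintro t s ⟨a, f, hf, h⟩
    refine Prod.ext ?_ ?_
    · funext i j
      obtain ⟨-, hbi, hvi⟩ := h i
      obtain ⟨-, hbj, hvj⟩ := h j
      refine propext ⟨fun e => ?_, fun e => ?_⟩
      · exact CFIVertex.ext (by rw [hbi, hbj, e]) (by rw [hvi, hvj, e])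
      · have hb : (t i).base = (t j).base := by rw [← hbi, ← hbj, e]
        refine CFIVertex.ext hb (add_right_cancel (b := f (t i).base) ?_)
        rw [← hvi, e, hvj, hb]
    · funext i j
      obtain ⟨-, hbi, hvi⟩ := h i
      obtain ⟨-, hbj, hvj⟩ := h j
      change ((t i).base ≠ (t j).base ∧ _ = (0 : ZMod 2) + 0) =
        ((s i).base ≠ (s j).base ∧ _ = _)
      rw [hbi, hbj, hvi, hvj]
      refine propext (and_congr_right fun hne => ?_)
      rw [← hf.edge _ _ hne, Pi.add_apply, Pi.add_apply, add_add_add_comm, add_eq_right, add_zero]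
  step := by
    rintro t s ⟨a, f, hf, h⟩ j
    obtain ⟨b, hb⟩ : ∃ b, b ∉ insert a ((Finset.univ.erase j).image fun i => (t i).base) := by
      by_contra! hall
      have hle := Finset.card_le_card (fun b _ => hall b : Finset.univ ⊆ _)
      have h₁ := Finset.card_insert_le a ((Finset.univ.erase j).image fun i => (t i).base)
      have h₂ := Finset.card_image_le (s := Finset.univ.erase j) (f := fun i => (t i).base)
      rw [Finset.card_erase_of_mem (Finset.mem_univ j)] at h₂
      simp only [Finset.card_univ, Fintype.card_fin] at hle h₂
      have := j.isLt
      omega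
    simp only [Finset.mem_insert, Finset.mem_image, Finset.mem_erase, Finset.mem_univ, and_true,
      not_or, not_exists, not_and] at hb
    obtain ⟨hba, hbt⟩ := hb
    obtain ⟨ψ, f', hf', hff', hψb, hψ, hψa⟩ := hf.exists_equiv (Ne.symm hba)
    refine ⟨ψ, fun v => ?_⟩
    by_cases hv : v.base = a
    · refine ⟨b, f', hf', fun i => ?_⟩
      rcases eq_or_ne i j with rfl | hij
      · simp only [Function.update_self]
        exact ⟨hv ▸ Ne.symm hba, hψb v, hψa v hv⟩
      · simp only [Function.update_of_ne hij]
        obtain ⟨h₁, h₂, h₃⟩ := h i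
        exact ⟨hbt i hij, h₂, by rw [h₃, hff' _ h₁ (hbt i hij)]⟩
    · refine ⟨a, f, hf, fun i => ?_⟩
      rcases eq_or_ne i j with rfl | hij
      · simp only [Function.update_self]
        exact ⟨hv, hψb v, hψ v hv⟩
      · simp only [Function.update_of_ne hij]
        exact h i
  reindex := by
    rintro t s ⟨a, f, hf, h⟩ π
    exact ⟨a, f, hf, fun i => h (π i)⟩

theorem exists_equiv_cfiPosition {n k : ℕ} (f₀ : Fin n → Fin n → ZMod 2) {a b : Fin n}
    (hab : a ≠ b) (hf₀ : IsTwistAt f₀ a f₀) :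
    ∃ ψ : CFIVertex n ≃ CFIVertex n, ∀ v,
      CFIPosition f₀ (fun _ : Fin k => v) (fun _ => ψ v) := by
  obtain ⟨ψ, f', hf', -, hψb, hψ, hψa⟩ := hf₀.exists_equiv hab
  refine ⟨ψ, fun v => ?_⟩
  by_cases hv : v.base = a
  · exact ⟨b, f', hf', fun _ => ⟨hv ▸ hab, hψb v, hψa v hv⟩⟩
  · exact ⟨a, f₀, hf₀, fun _ => ⟨hv, hψb v, hψ v hv⟩⟩

theorem isTwistAt_single {n : ℕ} {a b : Fin n} (hab : a ≠ b) :
    IsTwistAt (Pi.single a (Pi.single b 1)) a (Pi.single a (Pi.single b 1)) where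
  diag v := by
    rcases eq_or_ne v a with rfl | hva <;> simp_all
  sum v := by
    rcases eq_or_ne v a with rfl | hva <;> simp_all
  edge _ _ _ := rfl

end CFI

/-- For every `k ≥ 2`: (a) the diagonal coloring of `(k+1)`-WL refines
that of `k`-WL; (b) 1-WL pre-colored with `Δ((k+1)-WL)` distinguishes every pair of graphs
distinguished by 1-WL pre-colored with `Δ(k-WL)`; and (c) there is a pair of
non-isomorphic graphs distinguished by the former but not by the latter. -/
theorem kwlDiag_succ_strictly_more_expressive (k : ℕ) (hk : 2 ≤ k) :
    (∀ (V₁ V₂ : Type) [Fintype V₁] [Fintype V₂]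
      (G₁ : SimpleGraph V₁) (G₂ : SimpleGraph V₂) (u w : V₁ ⊕ V₂),
      Sum.elim (kwlDiag (V₁ := V₁) (V₂ := V₂) G₁ (k + 1))
          (kwlDiag (V₁ := V₁) (V₂ := V₂) G₂ (k + 1)) u =
        Sum.elim (kwlDiag (V₁ := V₁) (V₂ := V₂) G₁ (k + 1))
          (kwlDiag (V₁ := V₁) (V₂ := V₂) G₂ (k + 1)) w →
      Sum.elim (kwlDiag (V₁ := V₁) (V₂ := V₂) G₁ k)
          (kwlDiag (V₁ := V₁) (V₂ := V₂) G₂ k) u =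
        Sum.elim (kwlDiag (V₁ := V₁) (V₂ := V₂) G₁ k)
          (kwlDiag (V₁ := V₁) (V₂ := V₂) G₂ k) w) ∧
    (∀ (V₁ V₂ : Type) [Fintype V₁] [Fintype V₂]
      (G₁ : SimpleGraph V₁) (G₂ : SimpleGraph V₂),
      (∃ m : ℕ, wlColors G₁ (kwlDiag (V₁ := V₁) (V₂ := V₂) G₁ k) m ≠
          wlColors G₂ (kwlDiag (V₁ := V₁) (V₂ := V₂) G₂ k) m) →
      (∃ m : ℕ, wlColors G₁ (kwlDiag (V₁ := V₁) (V₂ := V₂) G₁ (k + 1)) m ≠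
          wlColors G₂ (kwlDiag (V₁ := V₁) (V₂ := V₂) G₂ (k + 1)) m)) ∧
    (∃ (n : ℕ) (G₁ G₂ : SimpleGraph (Fin n)),
      ¬ Nonempty (G₁ ≃g G₂) ∧
      (∃ m : ℕ, wlColors G₁ (kwlDiag (V₁ := Fin n) (V₂ := Fin n) G₁ (k + 1)) m ≠
          wlColors G₂ (kwlDiag (V₁ := Fin n) (V₂ := Fin n) G₂ (k + 1)) m) ∧
      (∀ m : ℕ, wlColors G₁ (kwlDiag (V₁ := Fin n) (V₂ := Fin n) G₁ k) m =
          wlColors G₂ (kwlDiag (V₁ := Fin n) (V₂ := Fin n) G₂ k) m)) := by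
  refine ⟨fun V₁ V₂ _ _ G₁ G₂ u w h => kwlDiag_refines (by omega) G₁ G₂ u w h, ?_, ?_⟩
  · rintro V₁ V₂ _ _ G₁ G₂ ⟨m, hm⟩
    refine ⟨m, fun e => hm ?_⟩
    exact wlColors_eq_of_refines _ _ _ _ (kwlDiag_refines (by omega) G₁ G₂) G₁ G₂ m e
  · have h01 : (0 : Fin (k + 1)) ≠ Fin.last k := by
      rw [Ne, Fin.ext_iff]
      simp only [Fin.val_zero, Fin.val_last]
      omega
    let f₀ : Fin (k + 1) → Fin (k + 1) → ZMod 2 := Pi.single 0 (Pi.single (Fin.last k) 1)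
    have hf₀ : IsTwistAt f₀ 0 f₀ := isTwistAt_single h01
    let e := (Fintype.equivFin (CFIVertex (k + 1))).symm
    have hG : ∃ c : Fin (k + 1) → _, ∀ i j, i ≠ j →
        ((cfiGraph 0).comap e).Adj (c i) (c j) := by
      obtain ⟨c, hc⟩ := exists_cfiGraph_zero_clique (k + 1)
      exact ⟨e.symm ∘ c, fun i j hij => by simpa using hc i j hij⟩
    have hH : ¬ ∃ c : Fin (k + 1) → _, ∀ i j, i ≠ j →
        ((cfiGraph f₀).comap e).Adj (c i) (c j) := by
      rintro ⟨c, hc⟩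
      exact not_exists_cfiGraph_clique f₀ hf₀.diag (by simp [hf₀.sum]) ⟨e ∘ c, hc⟩
    refine ⟨_, (cfiGraph 0).comap e, (cfiGraph f₀).comap e, ?_, ⟨0, ?_⟩, fun m => ?_⟩
    · rintro ⟨φ⟩
      obtain ⟨c, hc⟩ := hG
      exact hH ⟨φ ∘ c, fun i j hij => φ.map_adj_iff.2 (hc i j hij)⟩
    · exact wlColors_kwlDiag_ne_of_clique _ _ k.succ_ne_zero hG hH
    · obtain ⟨ψ, hψ⟩ := exists_equiv_cfiPosition (k := k) f₀ h01 hf₀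
      refine ((isBackAndForth_cfiPosition k.lt_succ_self f₀).comap e e).wlColors_eq hk _ m
        ((e.trans ψ).trans e.symm) fun v => ?_
      simpa [Function.comp_def] using hψ (e v)
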